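/- Let n ≥ 1 and 1 ≤ p ≤ n, and equip S^n with the ℤ/2-action generated by the involution τ_{n,p}. Then the equivariant LS-category of S^n equals 2: the two τ_{n,p}-invariant open sets S^n∖{e_1} and S^n∖{−e_1} (where e_1 = (1,0,…,0)) cover S^n and each inclusion is ℤ/2-equivariantly homotopic to the constant map at a fixed point of τ_{n,p}, while S^n cannot be covered by a single such set; hence cat_{ℤ/2}(S^n) = 2. -/

import Mathlib

open Set

namespace Paper

/-- The unit sphere `S^n ⊂ ℝ^{n+1}`. -/
abbrev Sph (n : ℕ) : Type :=
  (Metric.sphere (0 : EuclideanSpace ℝ (Fin (n + 1))) 1 : Set (EuclideanSpace ℝ (Fin (n + 1))))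

/-- The linear isometry of `ℝ^{n+1}` fixing the first `p` coordinates and negating
the remaining ones. -/
noncomputable def tauLin (n p : ℕ) :
    EuclideanSpace ℝ (Fin (n + 1)) ≃ₗᵢ[ℝ] EuclideanSpace ℝ (Fin (n + 1)) :=
  LinearIsometryEquiv.piLpCongrRight 2
    (fun i : Fin (n + 1) => if (i : ℕ) < p then LinearIsometryEquiv.refl ℝ ℝ
      else LinearIsometryEquiv.neg ℝ)

/-- The involution `τ_{n,p}` of the sphere `S^n`:
`(y_1, …, y_{n+1}) ↦ (y_1, …, y_p, −y_{p+1}, …, −y_{n+1})`. -/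
noncomputable def tauSph (n p : ℕ) : Sph n → Sph n := fun x =>
  ⟨tauLin n p (x : EuclideanSpace ℝ (Fin (n + 1))), by
    have hx : ‖(x : EuclideanSpace ℝ (Fin (n + 1)))‖ = 1 :=
      mem_sphere_zero_iff_norm.mp x.2
    simp [mem_sphere_zero_iff_norm, (tauLin n p).norm_map, hx]⟩

/-- The `ℤ/2`-space `(X, τ)` admits an equivariant categorical cover of size `k`:
`X` is covered by `k` `τ`-invariant open sets, each of whose inclusions into `X`
is `ℤ/2`-equivariantly homotopic to a map taking values in a single orbit `{b, τ b}`. -/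
def HasEqCatCover {X : Type*} [TopologicalSpace X] (τ : X → X) (k : ℕ) : Prop :=
  ∃ U : Fin k → Set X,
    (∀ i, IsOpen (U i)) ∧ (⋃ i, U i) = univ ∧ (∀ i, τ '' U i = U i) ∧
    ∀ i, ∃ (b : X) (H : C(↥(U i) × unitInterval, X)),
      (∀ u : U i, H (u, 0) = (u : X)) ∧
      (∀ u : U i, H (u, 1) ∈ ({b, τ b} : Set X)) ∧
      ∀ (u : U i) (hu : τ (u : X) ∈ U i) (t : unitInterval),
        H (⟨τ (u : X), hu⟩, t) = τ (H (u, t))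

/-- The equivariant Lusternik–Schnirelmann category of the `ℤ/2`-space `(X, τ)`,
as an extended natural number. -/
noncomputable def eqCat {X : Type*} [TopologicalSpace X] (τ : X → X) : ℕ∞ :=
  sInf {k : ℕ∞ | ∃ m : ℕ, k = m ∧ HasEqCatCover τ m}

section NoRetraction

open MeasureTheory Metric
open scoped NNReal

variable {E : Type*} [NormedAddCommGroup E] [InnerProductSpace ℝ E]

/-- A function supported in the unit ball and Lipschitz there is Lipschitz. -/
theorem norm_sub_le_of_lipschitzOnWith_closedBall {u : E → E} {K : ℝ≥0}
    (hK : LipschitzOnWith K u (closedBall 0 1)) (hu : ∀ x, 1 ≤ ‖x‖ → u x = 0) (x y : E) :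
    ‖u x - u y‖ ≤ K * ‖x - y‖ := by
  have key : ∀ x y : E, ‖x‖ ≤ 1 → 1 ≤ ‖y‖ → ‖u x - u y‖ ≤ K * ‖x - y‖ := by
    intro x y hx hy
    obtain ⟨z, hz, hz1⟩ := (convex_segment x y).isPreconnected.intermediate_value
      (left_mem_segment ℝ x y) (right_mem_segment ℝ x y) continuous_norm.continuousOn
      (show (1 : ℝ) ∈ Icc ‖x‖ ‖y‖ from ⟨hx, hy⟩)
    have hz1 : ‖z‖ = 1 := hz1
    have h1 := hK.norm_sub_le (mem_closedBall_zero_iff.2 hx) (mem_closedBall_zero_iff.2 hz1.le)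
    have h2 := dist_add_dist_of_mem_segment hz
    rw [hu z hz1.ge] at h1
    rw [hu y hy]
    refine h1.trans (mul_le_mul_of_nonneg_left ?_ K.2)
    rw [← dist_eq_norm, ← dist_eq_norm, ← h2]
    linarith [dist_nonneg (x := z) (y := y)]
  rcases le_total ‖x‖ 1 with hx | hx <;> rcases le_total ‖y‖ 1 with hy | hy
  · exact hK.norm_sub_le (mem_closedBall_zero_iff.2 hx) (mem_closedBall_zero_iff.2 hy)
  · exact key x y hx hy
  · rw [norm_sub_rev, norm_sub_rev x]
    exact key y x hy hx
  · rw [hu x hx, hu y hy, sub_zero, norm_zero]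
    positivity

variable [FiniteDimensional ℝ E]

/-- A contractive perturbation of the identity has positive determinant. -/
theorem det_one_add_pos {A : E →L[ℝ] E} (hA : ‖A‖ < 1) : 0 < (1 + A).det := by
  have hne : ∀ s ∈ Icc (0 : ℝ) 1, (1 + s • A).det ≠ 0 := by
    intro s hs h0
    have hker := LinearMap.bot_lt_ker_of_det_eq_zero h0
    obtain ⟨v, hv, hv0⟩ := Submodule.exists_mem_ne_zero_of_ne_bot hker.ne'
    have hv' : v + s • A v = 0 := by simpa using hv
    have h1 : ‖v‖ = s * ‖A v‖ := by
      rw [← Real.norm_of_nonneg hs.1, ← norm_smul, ← norm_neg (s • A v),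
        ← eq_neg_of_add_eq_zero_left hv']
    have h2 : ‖A v‖ ≤ ‖A‖ * ‖v‖ := A.le_opNorm v
    have h3 : 0 < ‖v‖ := norm_pos_iff.2 hv0
    nlinarith [norm_nonneg (A v), hs.2, hs.1]
  have hcont : Continuous fun s : ℝ => (1 + s • A).det :=
    ContinuousLinearMap.continuous_det.comp (by fun_prop)
  by_contra! hle
  obtain ⟨s, hs, h0⟩ := intermediate_value_Icc' zero_le_one hcont.continuousOn
    (show (0 : ℝ) ∈ Icc _ _ from ⟨by simpa using hle, by simp [ContinuousLinearMap.det]⟩)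
  exact hne s hs h0

/-- Lagrange interpolation of the polynomial `t ↦ det (1 + t A)` at `t = 1`. -/
theorem exists_det_one_add_eq_sum {t : ℕ → ℝ} (ht : Function.Injective t) :
    ∃ c : ℕ → ℝ, ∑ i ∈ Finset.range (Module.finrank ℝ E + 1), c i = 1 ∧ ∀ A : E →L[ℝ] E,
      (1 + A).det =
        ∑ i ∈ Finset.range (Module.finrank ℝ E + 1), c i * (1 + t i • A).det := by
  set s := Finset.range (Module.finrank ℝ E + 1) with hs
  refine ⟨fun i => (Lagrange.basis s t i).eval 1, ?_, fun A => ?_⟩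
  · rw [← Polynomial.eval_finsetSum, Lagrange.sum_basis ht.injOn ⟨0, by simp [hs]⟩,
      Polynomial.eval_one]
  · let b := Module.finBasis ℝ E
    let M := LinearMap.toMatrix b b (A : E →ₗ[ℝ] E)
    let P : Polynomial ℝ := Matrix.det ((Polynomial.X : Polynomial ℝ) • M.map Polynomial.C +
      (1 : Matrix _ _ ℝ).map Polynomial.C)
    have hP : ∀ x : ℝ, P.eval x = (1 + x • A).det := by
      intro x
      have : (1 + x • A).det = LinearMap.det (1 + x • (A : E →ₗ[ℝ] E)) := rfl
      rw [this, ← LinearMap.det_toMatrix b, map_add, map_smul, LinearMap.toMatrix_one]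
      rw [← Polynomial.coe_evalRingHom, RingHom.map_det]
      congr 1
      ext i j
      rcases eq_or_ne i j with rfl | hij
      · simp [M]; ring
      · simp [M, hij]; ring
    have hdeg : P.degree < s.card := by
      refine lt_of_le_of_lt Polynomial.degree_le_natDegree ?_
      have := Polynomial.natDegree_det_X_add_C_le M 1
      rw [Fintype.card_fin] at this
      rw [hs, Finset.card_range]
      exact_mod_cast Nat.lt_succ_of_le this
    have h := congrArg (Polynomial.eval 1) (Lagrange.eq_interpolate ht.injOn hdeg)
    rw [Lagrange.interpolate_apply, Polynomial.eval_finsetSum] at h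
    simp only [Polynomial.eval_mul, Polynomial.eval_C, hP, one_smul] at h
    rw [h]
    exact Finset.sum_congr rfl fun i _ => mul_comm _ _

/-- There is no continuously differentiable retraction of the unit ball onto the unit sphere. -/
theorem not_contDiff_retraction {r : E → E} (hr : ContDiff ℝ 1 r) (hr1 : ∀ x, ‖r x‖ = 1)
    (hrs : ∀ x, ‖x‖ = 1 → r x = x) : False := by
  borelize E
  have hEn : Nontrivial E := ⟨r 0, 0, norm_ne_zero_iff.1 (by simp [hr1])⟩
  set u : E → E := fun x => if ‖x‖ ≤ 1 then r x - x else 0 with hu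
  have hu0 : ∀ x, 1 ≤ ‖x‖ → u x = 0 := by
    intro x hx
    rcases hx.eq_or_lt with h | h
    · simp [hu, hrs x h.symm]
    · simp [hu, h]
  have hrC : ContDiff ℝ 1 fun x => r x - x := hr.sub contDiff_id
  obtain ⟨K₀, hK₀⟩ := hrC.contDiffOn.exists_lipschitzOnWith one_ne_zero
    (convex_closedBall (0 : E) 1) (isCompact_closedBall 0 1)
  set K : ℝ≥0 := K₀ + 1 with hKdef
  have hK : LipschitzOnWith K u (closedBall 0 1) :=
    fun x hx y hy => by
      simp only [hu, mem_closedBall_zero_iff.1 hx, mem_closedBall_zero_iff.1 hy, if_true]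
      exact hK₀.weaken le_self_add hx hy
  have hlip := norm_sub_le_of_lipschitzOnWith_closedBall hK hu0
  set A : E → E →L[ℝ] E := fun x => fderiv ℝ r x - 1 with hAdef
  have hA : ∀ x, HasFDerivAt (fun x => r x - x) (A x) x := fun x =>
    ((hr.differentiable one_ne_zero x).hasFDerivAt).sub (hasFDerivAt_id x)
  have huA : ∀ x ∈ ball (0 : E) 1, HasFDerivAt u (A x) x := fun x hx => by
    refine (hA x).congr_of_eventuallyEq ?_
    filter_upwards [isOpen_ball.mem_nhds hx] with y hy
    simp [hu, (mem_ball_zero_iff.1 hy).le]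
  have hAnorm : ∀ x ∈ ball (0 : E) 1, ‖A x‖ ≤ K := fun x hx => by
    rw [← (huA x hx).fderiv]
    exact norm_fderiv_le_of_lipschitzOn ℝ
      (Filter.mem_of_superset (isOpen_ball.mem_nhds hx) ball_subset_closedBall) hK
  have hAcont : Continuous A := (hr.continuous_fderiv one_ne_zero).sub continuous_const
  have hdetcont : ∀ t : ℝ, Continuous fun x => (1 + t • A x).det := fun t =>
    ContinuousLinearMap.continuous_det.comp (by fun_prop)
  have hint : ∀ t : ℝ, IntegrableOn (fun x => (1 + t • A x).det) (ball 0 1) volume := fun t =>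
    ((hdetcont t).continuousOn.integrableOn_compact (isCompact_closedBall 0 1)).mono_set
      ball_subset_closedBall
  -- for small `t`, the map `x ↦ x + t u(x)` is a bijection of the ball
  have hvol : ∀ t : ℝ, 0 < t → t * K < 1 →
      ∫ x in ball (0 : E) 1, (1 + t • A x).det = ∫ _ in ball (0 : E) 1, (1 : ℝ) := by
    intro t ht htK
    set F : E → E := fun x => x + t • u x with hF
    have happ : ApproximatesLinearOn F (ContinuousLinearEquiv.refl ℝ E : E →L[ℝ] E) univ
        (t.toNNReal * K) := by
      intro x _ y _
      have : F x - F y - (ContinuousLinearEquiv.refl ℝ E : E →L[ℝ] E) (x - y) =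
          t • (u x - u y) := by
        simp only [hF, ContinuousLinearEquiv.coe_refl, ContinuousLinearMap.coe_id', id]
        module
      rw [this, norm_smul, Real.norm_of_nonneg ht.le, NNReal.coe_mul, Real.coe_toNNReal t ht.le,
        mul_assoc]
      exact mul_le_mul_of_nonneg_left (hlip x y) ht.le
    have hc : Subsingleton E ∨ t.toNNReal * K <
        ‖((ContinuousLinearEquiv.refl ℝ E).symm : E →L[ℝ] E)‖₊⁻¹ := by
      right
      have : ‖((ContinuousLinearEquiv.refl ℝ E).symm : E →L[ℝ] E)‖₊ = 1 := by
        ext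
        exact ContinuousLinearMap.norm_id
      rw [this, inv_one, ← NNReal.coe_lt_coe, NNReal.coe_mul, Real.coe_toNNReal t ht.le]
      exact htK
    have hinj : Function.Injective F := injOn_univ.1 (happ.injOn hc)
    have hbij : Function.Bijective F := ⟨hinj, happ.surjective hc⟩
    have himg : F '' ball 0 1 = ball 0 1 := by
      rw [← compl_inj_iff, ← image_compl_eq hbij]
      refine (image_congr fun x hx => ?_).trans (image_id _)
      have : 1 ≤ ‖x‖ := by simpa using hx
      simp [hF, hu0 x this]
    have hFd : ∀ x ∈ ball (0 : E) 1, HasFDerivWithinAt F (1 + t • A x) (ball 0 1) x :=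
      fun x hx => ((hasFDerivAt_id x).add ((huA x hx).const_smul t)).hasFDerivWithinAt
    have h := integral_image_eq_integral_abs_det_fderiv_smul volume measurableSet_ball hFd
      hinj.injOn (fun _ => (1 : ℝ))
    rw [himg] at h
    rw [h]
    refine setIntegral_congr_fun measurableSet_ball fun x hx => ?_
    have hlt : ‖t • A x‖ < 1 := by
      rw [norm_smul, Real.norm_of_nonneg ht.le]
      exact (mul_le_mul_of_nonneg_left (hAnorm x hx) ht.le).trans_lt htK
    simp [abs_of_pos (det_one_add_pos hlt)]
  have hKpos : (0 : ℝ) < K := NNReal.coe_pos.2 (zero_lt_one.trans_le le_add_self)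
  set t : ℕ → ℝ := fun i => 1 / ((i + 2) * K) with ht
  have htinj : Function.Injective t := by
    intro i j hij
    have h : ((i : ℝ) + 2) * K = (j + 2) * K := by
      simp only [ht, one_div] at hij
      exact inv_injective hij
    have := mul_right_cancel₀ hKpos.ne' h
    exact_mod_cast add_right_cancel this
  have htpos : ∀ i, 0 < t i := fun i => by simp only [ht]; positivity
  have htlt : ∀ i, t i * K < 1 := fun i => by
    have : t i * K = 1 / (i + 2) := by simp only [ht]; field_simp
    rw [this, div_lt_one (by positivity)]
    linarith [(Nat.cast_nonneg i : (0 : ℝ) ≤ i)]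
  obtain ⟨c, hc1, hc⟩ := exists_det_one_add_eq_sum (E := E) htinj
  have htotal : ∫ x in ball (0 : E) 1, (1 + A x).det = ∫ _ in ball (0 : E) 1, (1 : ℝ) := by
    rw [setIntegral_congr_fun measurableSet_ball fun x _ => hc (A x)]
    rw [integral_finsetSum _ fun i _ => (hint (t i)).const_mul (c i)]
    simp_rw [integral_const_mul, hvol _ (htpos _) (htlt _), ← Finset.sum_mul, hc1, one_mul]
  have hzero : ∀ x, (1 + A x).det = 0 := by
    intro x
    by_contra hne
    have hAx : 1 + A x = fderiv ℝ r x := by simp [hAdef]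
    rw [hAx] at hne
    have hunit : IsUnit (fderiv ℝ r x : E →ₗ[ℝ] E) :=
      (LinearMap.isUnit_iff_isUnit_det _).2 (isUnit_iff_ne_zero.2 hne)
    obtain ⟨v, hv⟩ := ((Module.End.isUnit_iff _).1 hunit).2 (r x)
    have hv : fderiv ℝ r x v = r x := hv
    have hd := (hr.differentiable one_ne_zero x).hasFDerivAt
    have h1 := hd.inner ℝ hd
    have h2 : (fun y => inner ℝ (r y) (r y)) = fun _ => (1 : ℝ) := by
      ext y; rw [real_inner_self_eq_norm_sq, hr1]; norm_num
    rw [h2] at h1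
    have h3 := congrArg (fun L : E →L[ℝ] ℝ => L v) (h1.unique (hasFDerivAt_const 1 x))
    simp [fderivInnerCLM_apply, hv, hr1] at h3
  simp_rw [hzero] at htotal
  simp only [integral_zero, integral_const, smul_eq_mul, mul_one, MeasurableSet.univ,
    measureReal_restrict_apply, univ_inter] at htotal
  exact (ENNReal.toReal_pos (measure_ball_pos volume (0 : E) one_pos).ne'
    measure_ball_lt_top.ne).ne htotal

/-- The identity of the unit sphere is not homotopic to a constant map. -/
theorem not_sphere_contraction (H : C(sphere (0 : E) 1 × unitInterval, sphere (0 : E) 1))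
    (h0 : ∀ x, H (x, 0) = x) (b : sphere (0 : E) 1) (h1 : ∀ x, H (x, 1) = b) : False := by
  classical
  let s : E → unitInterval := fun x => projIcc 0 1 zero_le_one (3 - 4 * ‖x‖)
  have hs : Continuous s := continuous_projIcc.comp (by fun_prop)
  have hs1 : ∀ x, ‖x‖ ≤ 1 / 2 → s x = 1 := fun x hx =>
    projIcc_of_right_le _ (by linarith)
  have hs0 : ∀ x, 3 / 4 ≤ ‖x‖ → s x = 0 := fun x hx =>
    projIcc_of_le_left _ (by linarith)
  let N : E → sphere (0 : E) 1 := fun x =>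
    if h : x = 0 then b else ⟨‖x‖⁻¹ • x, by simp [norm_smul, h]⟩
  have hNval : ∀ x, x ≠ 0 → (N x : E) = ‖x‖⁻¹ • x := fun x hx => by simp [N, hx]
  have hN : ContinuousOn N {0}ᶜ := by
    rw [Topology.IsInducing.subtypeVal.continuousOn_iff]
    refine ContinuousOn.congr (f := fun x : E => ‖x‖⁻¹ • x) ?_ fun x hx => hNval x hx
    exact (continuous_norm.continuousOn.inv₀ fun x hx => norm_ne_zero_iff.2 hx).smul
      continuousOn_id
  let f : E → E := fun x => H (N x, s x)
  have hf : Continuous f := by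
    refine continuous_subtype_val.comp (continuous_iff_continuousAt.2 fun x => ?_)
    rcases eq_or_ne x 0 with rfl | hx
    · refine (continuousAt_const (y := b)).congr ?_
      filter_upwards [ball_mem_nhds (0 : E) one_half_pos] with y hy
      rw [hs1 y (mem_ball_zero_iff.1 hy).le, h1]
    · have hNx : ContinuousAt N x := hN.continuousAt (isOpen_compl_singleton.mem_nhds hx)
      exact H.continuous.continuousAt.comp (hNx.prodMk hs.continuousAt)
  have hf1 : ∀ x, ‖f x‖ = 1 := fun x => mem_sphere_zero_iff_norm.1 (H _).2
  have hfN : ∀ x, 3 / 4 ≤ ‖x‖ → f x = ‖x‖⁻¹ • x := fun x hx => by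
    have : x ≠ 0 := norm_pos_iff.1 (by linarith)
    simp only [f]
    rw [hs0 x hx, h0, hNval x this]
  obtain ⟨g, hg, hgf, hgS, -⟩ := hf.exists_contDiff_approx_and_eqOn (n := 1)
    (ε := fun _ => 1) continuous_const (fun _ => one_pos) (S := sphere 0 1)
    (U := {x | 3 / 4 < ‖x‖}) isClosed_sphere
    ((isOpen_lt continuous_const continuous_norm).mem_nhdsSet.2 fun x hx => by
      rw [mem_sphere_zero_iff_norm] at hx
      simp only [mem_ofPred_eq, hx]; norm_num)
    (by
      have : ContDiffOn ℝ (1 : ℕ∞) (fun x : E => ‖x‖⁻¹ • x) {x | 3 / 4 < ‖x‖} := by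
        have hne : ∀ x ∈ {x : E | 3 / 4 < ‖x‖}, x ≠ 0 := fun x hx =>
          norm_pos_iff.1 (lt_trans (by norm_num) hx)
        exact ((contDiffOn_id.norm ℝ hne).inv fun x hx => norm_ne_zero_iff.2 (hne x hx)).smul
          contDiffOn_id
      exact this.congr fun x hx => hfN x (le_of_lt hx))
  have hg0 : ∀ x, g x ≠ 0 := fun x hx => by
    have := hgf x
    rw [hx, dist_zero_left, hf1] at this
    exact lt_irrefl _ this
  refine not_contDiff_retraction (r := fun x => ‖g x‖⁻¹ • g x) ?_ ?_ ?_
  · exact ((hg.norm ℝ hg0).inv fun x => norm_ne_zero_iff.2 (hg0 x)).smul hg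
  · intro x
    simp [norm_smul, hg0 x]
  · intro x hx
    have : g x = x := by
      rw [hgS (mem_sphere_zero_iff_norm.2 hx), hfN x (by rw [hx]; norm_num), hx, inv_one, one_smul]
    simp [this, hx]

end NoRetraction
/-- If `τ` fixes `v`, the complement of `-v` contracts equivariantly to `v` along the normalized
straight-line homotopy. -/
theorem exists_equivariant_contraction {n p : ℕ} (v : Sph n)
    (hv : tauLin n p (v : EuclideanSpace ℝ (Fin (n + 1))) = v) :
    ∃ H : C(↥({-v}ᶜ : Set (Sph n)) × unitInterval, Sph n),
      (∀ u, H (u, 0) = (u : Sph n)) ∧ (∀ u, H (u, 1) = v) ∧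
      ∀ (u : ↥({-v}ᶜ : Set (Sph n))) (hu : tauSph n p (u : Sph n) ∈ ({-v}ᶜ : Set (Sph n)))
        (t : unitInterval), H (⟨tauSph n p (u : Sph n), hu⟩, t) = tauSph n p (H (u, t)) := by
  let L : ↥({-v}ᶜ : Set (Sph n)) × unitInterval → EuclideanSpace ℝ (Fin (n + 1)) :=
    fun q => (1 - (q.2 : ℝ)) • ((q.1 : Sph n) : EuclideanSpace ℝ (Fin (n + 1))) + (q.2 : ℝ) • v
  have hnorm (x : Sph n) : ‖(x : EuclideanSpace ℝ (Fin (n + 1)))‖ = 1 :=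
    mem_sphere_zero_iff_norm.1 x.2
  have hL : Continuous L := by fun_prop
  have hL0 : ∀ q, L q ≠ 0 := by
    rintro ⟨⟨u, hu⟩, t⟩ h
    have h1 : (1 - (t : ℝ)) • (u : EuclideanSpace ℝ (Fin (n + 1))) = -((t : ℝ) • (v : _)) :=
      eq_neg_of_add_eq_zero_left h
    have h2 := congrArg norm h1
    rw [norm_neg, norm_smul, norm_smul, hnorm, hnorm, mul_one, mul_one,
      Real.norm_of_nonneg t.2.1, Real.norm_of_nonneg (sub_nonneg.2 t.2.2)] at h2
    rw [h2, ← smul_neg] at h1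
    have ht : (t : ℝ) ≠ 0 := by linarith
    exact hu (Subtype.ext (smul_right_injective _ ht h1))
  have hmem : ∀ q, ‖L q‖⁻¹ • L q ∈ Metric.sphere (0 : EuclideanSpace ℝ (Fin (n + 1))) 1 :=
    fun q => by simp [norm_smul, hL0 q]
  refine ⟨⟨fun q => ⟨‖L q‖⁻¹ • L q, hmem q⟩,
    ((hL.norm.inv₀ fun q => norm_ne_zero_iff.2 (hL0 q)).smul hL).subtype_mk hmem⟩, ?_, ?_, ?_⟩
  · intro u
    ext1
    simp [L]
  · intro u
    ext1
    simp [L]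
  · intro u hu t
    have h : L (⟨tauSph n p (u : Sph n), hu⟩, t) = tauLin n p (L (u, t)) := by
      simp [L, tauSph, hv]
    ext1
    change ‖L (⟨tauSph n p (u : Sph n), hu⟩, t)‖⁻¹ • L (⟨tauSph n p (u : Sph n), hu⟩, t) =
      tauLin n p (‖L (u, t)‖⁻¹ • L (u, t))
    rw [h, LinearIsometryEquiv.norm_map, map_smul]

theorem tauLin_tauLin (n p : ℕ) (x : EuclideanSpace ℝ (Fin (n + 1))) :
    tauLin n p (tauLin n p x) = x := by
  ext i
  simp only [tauLin, LinearIsometryEquiv.piLpCongrRight_apply]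
  split_ifs <;> simp

theorem tauSph_involutive (n p : ℕ) : Function.Involutive (tauSph n p) := fun x =>
  Subtype.ext (tauLin_tauLin n p x)

theorem tauLin_single_zero {n p : ℕ} (hp : 1 ≤ p) :
    tauLin n p (EuclideanSpace.single 0 1) = EuclideanSpace.single 0 1 := by
  ext i
  rcases eq_or_ne i 0 with rfl | hi
  · have : 0 < p := hp
    simp [tauLin, this]
  · simp only [tauLin, LinearIsometryEquiv.piLpCongrRight_apply]
    split_ifs <;> simp [hi]

theorem hasEqCatCover_tauSph_two {n p : ℕ} (hp : 1 ≤ p) : HasEqCatCover (tauSph n p) 2 := by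
  let e : Sph n := ⟨EuclideanSpace.single 0 1, by simp⟩
  let w : Fin 2 → Sph n := ![e, -e]
  have hw : ∀ i, tauLin n p (w i : EuclideanSpace ℝ (Fin (n + 1))) = w i := by
    have he : tauLin n p (e : EuclideanSpace ℝ (Fin (n + 1))) = e := tauLin_single_zero hp
    intro i
    fin_cases i
    · exact he
    · change tauLin n p (-(e : EuclideanSpace ℝ (Fin (n + 1)))) = -e
      rw [map_neg, he]
  refine ⟨fun i => {-w i}ᶜ, fun i => isOpen_compl_singleton, ?_, fun i => ?_, fun i => ?_⟩
  · refine eq_univ_of_forall fun x => mem_iUnion.2 ?_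
    by_contra! h
    have h0 : x = -e := by simpa [w] using h 0
    have h1 : x = e := by simpa [w] using h 1
    exact ne_neg_of_mem_unit_sphere ℝ e (h1.symm.trans h0)
  · have : tauSph n p (-w i) = -w i := Subtype.ext (by
      change tauLin n p (-(w i : EuclideanSpace ℝ (Fin (n + 1)))) = -w i
      rw [map_neg, hw])
    rw [image_compl_eq (tauSph_involutive n p).bijective, image_singleton, this]
  · obtain ⟨H, h0, h1, h2⟩ := exists_equivariant_contraction (w i) (hw i)
    exact ⟨w i, H, h0, fun u => Or.inl (h1 u), h2⟩

theorem not_hasEqCatCover_tauSph_one {n p : ℕ} (hn : 1 ≤ n) :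
    ¬ HasEqCatCover (tauSph n p) 1 := by
  rintro ⟨U, -, hU, -, hH⟩
  obtain ⟨b, H, h0, h1, -⟩ := hH 0
  have hU0 : ∀ x, x ∈ U 0 := fun x => by
    obtain ⟨i, hi⟩ := mem_iUnion.1 (hU ▸ mem_univ x)
    rwa [Subsingleton.elim 0 i]
  let G : C(Sph n × unitInterval, Sph n) :=
    ⟨fun q => H (⟨q.1, hU0 q.1⟩, q.2), by fun_prop⟩
  have hrank : 1 < Module.rank ℝ (EuclideanSpace ℝ (Fin (n + 1))) := by
    rw [← Module.finrank_eq_rank, finrank_euclideanSpace_fin]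
    exact_mod_cast Nat.lt_succ_of_le hn
  have : PreconnectedSpace (Sph n) :=
    isPreconnected_iff_preconnectedSpace.1 (isPreconnected_sphere hrank _ _)
  have hpre : IsPreconnected (range fun x => G (x, 1)) := isPreconnected_range (by fun_prop)
  have hfin : (range fun x => G (x, 1)).Finite :=
    (toFinite {b, tauSph n p b}).subset (range_subset_iff.2 fun x => h1 ⟨x, hU0 x⟩)
  have hsub : (range fun x => G (x, 1)).Subsingleton := by
    by_contra h
    exact hpre.infinite_of_nontrivial (not_subsingleton_iff.1 h) hfin
  let e : Sph n := ⟨EuclideanSpace.single 0 1, by simp⟩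
  exact not_sphere_contraction G (fun x => h0 ⟨x, hU0 x⟩) (G (e, 1)) fun x =>
    hsub (mem_range_self x) (mem_range_self e)

/-- **Equivariant LS-category of the sphere.**  For `n ≥ 1` and `1 ≤ p ≤ n`, the
equivariant LS-category of `S^n` with the `ℤ/2`-action generated by `τ_{n,p}`
equals `2`. -/
theorem eqcat_sphere (n p : ℕ) (hn : 1 ≤ n) (hp1 : 1 ≤ p) (hpn : p ≤ n) :
    eqCat (tauSph n p) = 2 := by
  apply le_antisymm
  · exact sInf_le ⟨2, rfl, hasEqCatCover_tauSph_two hp1⟩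
  · refine le_sInf ?_
    rintro _ ⟨m, rfl, hm⟩
    match m, hm with
    | 0, ⟨U, _, hU, _⟩ =>
      have hx : (⟨EuclideanSpace.single 0 1, by simp⟩ : Sph n) ∈ ⋃ i, U i := hU ▸ mem_univ _
      obtain ⟨i, -⟩ := mem_iUnion.1 hx
      exact i.elim0
    | 1, hm => exact absurd hm (not_hasEqCatCover_tauSph_one hn)
    | m + 2, _ => exact_mod_cast Nat.le_add_left 2 m

end Paper
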